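/- arXiv:2209.10344 — 5 statements merged into one kernel-verified Lean document; each statement's English description precedes it below -/
import Mathlib

section
/- Let M ≥ 3 be an odd integer, let S_c be an ((M+1)/2)×((M+1)/2) real symmetric positive definite matrix, and let χ̂ > 0. Set B_c = [χ̂S_c, M_c] ∈ R^{((M+1)/2)×(M+1)} (the horizontal block concatenation). Then the boundary conditions determined by B_c are strictly dissipative for the symmetric hyperbolic operator with boundary matrix A_c: there exists a constant c > 0 such that y^T A_c y ≤ −c|y|² + c^{-1}|B_c y|² for all y ∈ R^{M+1}. -/
open Matrix

/-- The `((M+1)/2) × ((M+1)/2)` lower bidiagonal matrix `M_c` with (0-indexed)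
diagonal entries `√(2i+1)` and subdiagonal entries `√(2i)`, i.e. rows
`(1), (√2,√3), (√4,√5), …`. -/
noncomputable def Mc (n : ℕ) : Matrix (Fin n) (Fin n) ℝ :=
  Matrix.of fun i j =>
    if (j : ℕ) = (i : ℕ) then Real.sqrt (2 * (i : ℕ) + 1)
    else if (j : ℕ) + 1 = (i : ℕ) then Real.sqrt (2 * (i : ℕ)) else 0

/-- The symmetric block matrix `A_c = [[0, M_c],[M_cᵀ, 0]]`. -/
noncomputable def Ac (n : ℕ) : Matrix (Fin n ⊕ Fin n) (Fin n ⊕ Fin n) ℝ :=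
  Matrix.fromBlocks 0 (Mc n) (Mc n)ᵀ 0

/-- The boundary matrix `B_c = [χ̂ S_c, M_c]` (horizontal block concatenation). -/
noncomputable def Bc (n : ℕ) (χ : ℝ) (S : Matrix (Fin n) (Fin n) ℝ) :
    Matrix (Fin n) (Fin n ⊕ Fin n) ℝ :=
  Matrix.of fun i j => Sum.elim (fun j' => χ * S i j') (fun j' => Mc n i j') j

/-- Finsler's lemma for real quadratic functions on a finite-dimensional space: if `q` is negative
wherever `g` vanishes (away from the origin), then `q ≤ -c * p + c⁻¹ * g` for some `c > 0`. -/
theorem exists_pos_le_neg_mul_add_inv_mul {E : Type*} [NormedAddCommGroup E] [NormedSpace ℝ E]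
    [ProperSpace E] {q p g : E → ℝ} (hq : Continuous q) (hp : Continuous p) (hg : Continuous g)
    (hq2 : ∀ (t : ℝ) (y : E), q (t • y) = t ^ 2 * q y)
    (hp2 : ∀ (t : ℝ) (y : E), p (t • y) = t ^ 2 * p y)
    (hg2 : ∀ (t : ℝ) (y : E), g (t • y) = t ^ 2 * g y)
    (hp0 : ∀ y, 0 ≤ p y) (hg0 : ∀ y, 0 ≤ g y) (hneg : ∀ y, y ≠ 0 → g y = 0 → q y < 0) :
    ∃ c : ℝ, 0 < c ∧ ∀ y, q y ≤ -c * p y + c⁻¹ * g y := by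
  let U : ℕ → Set E := fun n => {y | q y < -((n : ℝ) + 1)⁻¹ * p y + ((n : ℝ) + 1) * g y}
  have hUopen : ∀ n, IsOpen (U n) := fun n => isOpen_lt hq (by fun_prop)
  have hUmono : Monotone U := by
    intro m n hmn y hy
    have hmn' : (m : ℝ) + 1 ≤ n + 1 := by gcongr
    have h1 : ((n : ℝ) + 1)⁻¹ * p y ≤ ((m : ℝ) + 1)⁻¹ * p y :=
      mul_le_mul_of_nonneg_right (inv_anti₀ (by positivity) hmn') (hp0 y)
    have h2 := mul_le_mul_of_nonneg_right hmn' (hg0 y)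
    simp only [U, Set.mem_ofPred_eq] at hy ⊢
    linarith
  have hcover : Metric.sphere (0 : E) 1 ⊆ ⋃ n, U n := by
    intro y hy
    have hy0 : y ≠ 0 := ne_zero_of_mem_unit_sphere ⟨y, hy⟩
    rw [Set.mem_iUnion]
    rcases (hg0 y).eq_or_lt with h | h
    · have hqy := hneg y hy0 h.symm
      obtain ⟨n, hn⟩ := exists_nat_gt (p y / -q y)
      rw [div_lt_iff₀ (by linarith)] at hn
      refine ⟨n, ?_⟩
      simp only [U, Set.mem_ofPred_eq]
      have : ((n : ℝ) + 1)⁻¹ * p y < -q y := by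
        rw [inv_mul_lt_iff₀ (by positivity)]
        linarith
      rw [← h]
      linarith
    · obtain ⟨n, hn⟩ := exists_nat_gt ((q y + p y) / g y)
      rw [div_lt_iff₀ h] at hn
      refine ⟨n, ?_⟩
      simp only [U, Set.mem_ofPred_eq]
      have : ((n : ℝ) + 1)⁻¹ * p y ≤ p y :=
        mul_le_of_le_one_left (hp0 y) (inv_le_one_of_one_le₀ (by simp))
      linarith
  obtain ⟨n, hn⟩ := (isCompact_sphere (0 : E) 1).elim_directed_cover U hUopen hcover
    hUmono.directed_le
  refine ⟨((n : ℝ) + 1)⁻¹, by positivity, fun y => ?_⟩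
  rw [inv_inv]
  rcases eq_or_ne y 0 with rfl | hy
  · have hq0 := hq2 0 0
    have hp0' := hp2 0 0
    have hg0' := hg2 0 0
    simp only [smul_zero, ne_eq, OfNat.ofNat_ne_zero, not_false_eq_true, zero_pow,
      zero_mul] at hq0 hp0' hg0'
    simp [hq0, hp0', hg0']
  · have hmem : ‖y‖⁻¹ • y ∈ U n := hn (by simp [norm_smul, hy])
    have hlt : q (‖y‖⁻¹ • y) < -((n : ℝ) + 1)⁻¹ * p (‖y‖⁻¹ • y)
      + ((n : ℝ) + 1) * g (‖y‖⁻¹ • y) := hmem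
    rw [hq2, hp2, hg2] at hlt
    have hpos : 0 < ‖y‖⁻¹ ^ 2 := by positivity
    refine le_of_lt (lt_of_mul_lt_mul_left ?_ hpos.le)
    linarith

theorem Mc_det_ne_zero (n : ℕ) : (Mc n).det ≠ 0 := by
  rw [Matrix.det_of_isLowerTriangular]
  · refine Finset.prod_ne_zero_iff.mpr fun i _ => ?_
    simp only [Mc, Matrix.of_apply, if_true]
    positivity
  · intro i j hij
    have hlt : (i : ℕ) < j := hij
    simp only [Mc, Matrix.of_apply]
    rw [if_neg (by omega), if_neg (by omega)]

theorem Bc_mulVec (n : ℕ) (χ : ℝ) (S : Matrix (Fin n) (Fin n) ℝ) (y : Fin n ⊕ Fin n → ℝ) :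
    Bc n χ S *ᵥ y = χ • (S *ᵥ (y ∘ Sum.inl)) + Mc n *ᵥ (y ∘ Sum.inr) := by
  ext i
  simp [Bc, Matrix.mulVec, dotProduct, Finset.mul_sum, mul_assoc]

theorem dotProduct_Ac_mulVec (n : ℕ) (y : Fin n ⊕ Fin n → ℝ) :
    y ⬝ᵥ (Ac n *ᵥ y) = 2 * ((y ∘ Sum.inl) ⬝ᵥ (Mc n *ᵥ (y ∘ Sum.inr))) := by
  obtain ⟨u, v, rfl⟩ : ∃ u v : Fin n → ℝ, y = Sum.elim u v :=
    ⟨y ∘ Sum.inl, y ∘ Sum.inr, (Sum.elim_comp_inl_inr y).symm⟩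
  rw [Ac, Matrix.fromBlocks_mulVec, sumElim_dotProduct_sumElim]
  simp only [Sum.elim_comp_inl, Sum.elim_comp_inr, Matrix.zero_mulVec, zero_add, add_zero]
  rw [Matrix.mulVec_transpose, dotProduct_comm v, ← Matrix.dotProduct_mulVec, two_mul]

theorem dotProduct_Ac_mulVec_neg {n : ℕ} {χ : ℝ} (hχ : 0 < χ) {S : Matrix (Fin n) (Fin n) ℝ}
    (hS : S.PosDef) {y : Fin n ⊕ Fin n → ℝ} (hy : y ≠ 0) (hB : Bc n χ S *ᵥ y = 0) :
    y ⬝ᵥ (Ac n *ᵥ y) < 0 := by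
  rw [Bc_mulVec] at hB
  have hu : y ∘ Sum.inl ≠ 0 := by
    intro hu
    rw [hu, Matrix.mulVec_zero, smul_zero, zero_add] at hB
    have hv := Matrix.eq_zero_of_mulVec_eq_zero (Mc_det_ne_zero n) hB
    apply hy
    rw [← Sum.elim_comp_inl_inr y, hu, hv, Sum.elim_zero_zero]
  rw [dotProduct_Ac_mulVec, eq_neg_of_add_eq_zero_right hB, dotProduct_neg, dotProduct_smul,
    smul_eq_mul]
  have hpos := hS.dotProduct_mulVec_pos hu
  rw [star_trivial] at hpos
  have := mul_pos hχ hpos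
  linarith

/-- The boundary conditions determined by `B_c = [χ̂ S_c, M_c]` are strictly
dissipative for the symmetric hyperbolic operator with boundary matrix `A_c`. -/
theorem grad_bc_strictly_dissipative (M : ℕ) (hM : 3 ≤ M) (hModd : Odd M)
    (S : Matrix (Fin ((M + 1) / 2)) (Fin ((M + 1) / 2)) ℝ) (hS : S.PosDef)
    (χ : ℝ) (hχ : 0 < χ) :
    ∃ c : ℝ, 0 < c ∧ ∀ y : Fin ((M + 1) / 2) ⊕ Fin ((M + 1) / 2) → ℝ,
      y ⬝ᵥ (Ac ((M + 1) / 2) *ᵥ y) ≤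
        -c * (y ⬝ᵥ y) +
          c⁻¹ * ((Bc ((M + 1) / 2) χ S *ᵥ y) ⬝ᵥ (Bc ((M + 1) / 2) χ S *ᵥ y)) := by
  refine exists_pos_le_neg_mul_add_inv_mul (by fun_prop) (by fun_prop) (by fun_prop)
    ?_ ?_ ?_ (fun y => ?_) (fun y => ?_) fun y hy hB =>
      dotProduct_Ac_mulVec_neg hχ hS hy (dotProduct_self_eq_zero.mp hB)
  any_goals
    intro t y
    simp only [Matrix.mulVec_smul, smul_dotProduct, dotProduct_smul, smul_eq_mul]
    ring
  all_goals exact Finset.sum_nonneg fun i _ => mul_self_nonneg _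
end

section
/- Let M ≥ 3 be an odd integer and χ̂ > 0. Then the ((M+1)/2)×((M+1)/2) matrix H_M(χ) := χ̂S_c·[[1, −ǧ^T R_e],[0, R_e]] + [[0, 0],[0, M̌_c R_o]] is invertible. -/
open Matrix

/-- The `((M−1)/2) × ((M−1)/2)` lower bidiagonal matrix `M̌_c` with (0-indexed)
diagonal entries `√(2i+3)` and subdiagonal entries `√(2i+2)`. -/
noncomputable def McK (k : ℕ) : Matrix (Fin k) (Fin k) ℝ :=
  Matrix.of fun i j =>
    if (j : ℕ) = (i : ℕ) then Real.sqrt (2 * (i : ℕ) + 3)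
    else if (j : ℕ) + 1 = (i : ℕ) then Real.sqrt (2 * (i : ℕ) + 2) else 0

/-- The symmetric block matrix `Ǎ_c = [[0, M̌_c],[M̌_cᵀ, 0]]`. -/
noncomputable def AcK (k : ℕ) : Matrix (Fin k ⊕ Fin k) (Fin k ⊕ Fin k) ℝ :=
  Matrix.fromBlocks 0 (McK k) (McK k)ᵀ 0

/-- The vector `ǧ = (√2, 0, …, 0)ᵀ ∈ ℝ^k`. -/
noncomputable def gCheck (k : ℕ) : Fin k → ℝ :=
  fun i => if (i : ℕ) = 0 then Real.sqrt 2 else 0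

/-- The matrix `H_M(χ) = χ̂ S_c [[1, −ǧᵀ R_e],[0, R_e]] + [[0,0],[0, M̌_c R_o]]`,
with blocks of sizes `1` and `(M−1)/2`. -/
noncomputable def Hmat (k : ℕ) (χ : ℝ)
    (S : Matrix (Fin 1 ⊕ Fin k) (Fin 1 ⊕ Fin k) ℝ)
    (Re Ro : Matrix (Fin k) (Fin k) ℝ) :
    Matrix (Fin 1 ⊕ Fin k) (Fin 1 ⊕ Fin k) ℝ :=
  χ • (S * Matrix.fromBlocks 1
        (Matrix.of fun (_ : Fin 1) j => -(Matrix.vecMul (gCheck k) Re j)) 0 Re) +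
    Matrix.fromBlocks 0 0 0 (McK k * Ro)

/-- `H_M(χ)` factors through a block upper triangular matrix. -/
theorem Hmat_eq_mul (k : ℕ) (χ : ℝ) (S : Matrix (Fin 1 ⊕ Fin k) (Fin 1 ⊕ Fin k) ℝ)
    (Re Ro : Matrix (Fin k) (Fin k) ℝ) (Λ : Fin k → ℝ)
    (hMR : McK k * Ro = Re * Matrix.diagonal Λ) (hRR : (2 : ℝ) • (Re * Reᵀ) = 1) :
    Hmat k χ S Re Ro =
      (χ • S + (2 : ℝ) • (fromRows 0 Re * Matrix.diagonal Λ * (fromRows 0 Re)ᴴ)) *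
        Matrix.fromBlocks 1
          (Matrix.of fun (_ : Fin 1) j => -(Matrix.vecMul (gCheck k) Re j)) 0 Re := by
  have hRR' : (2 : ℝ) • (Reᵀ * Re) = 1 := by
    rw [← Matrix.smul_mul]
    rw [← Matrix.mul_smul] at hRR
    exact mul_eq_one_comm.mp hRR
  have hP : (2 : ℝ) • (fromRows (0 : Matrix (Fin 1) (Fin k) ℝ) Re * Matrix.diagonal Λ *
      (fromRows (0 : Matrix (Fin 1) (Fin k) ℝ) Re)ᴴ) =
      fromBlocks 0 0 0 (Re * Matrix.diagonal Λ * ((2 : ℝ) • Reᵀ)) := by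
    rw [conjTranspose_fromRows_eq_fromCols_conjTranspose, fromRows_mul, fromRows_mul_fromCols,
      fromBlocks_smul]
    simp [conjTranspose_eq_transpose_of_trivial]
  rw [hP, add_mul, Matrix.smul_mul, Hmat, hMR, fromBlocks_multiply]
  simp only [Matrix.mul_assoc, Matrix.smul_mul, hRR', Matrix.mul_one, Matrix.mul_zero, Matrix.zero_mul,
    add_zero, zero_add]

/-- For odd `M ≥ 3` and `χ̂ > 0`, the matrix `H_M(χ)` is invertible. -/
theorem Hmat_invertible (M : ℕ) (hM : 3 ≤ M) (hModd : Odd M)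
    (χ : ℝ) (hχ : 0 < χ)
    (S : Matrix (Fin 1 ⊕ Fin ((M - 1) / 2)) (Fin 1 ⊕ Fin ((M - 1) / 2)) ℝ)
    (hS : S.PosDef)
    (Re Ro : Matrix (Fin ((M - 1) / 2)) (Fin ((M - 1) / 2)) ℝ)
    (Λ : Fin ((M - 1) / 2) → ℝ)
    (hRe : IsUnit Re.det) (hRo : IsUnit Ro.det) (hΛ : ∀ i, 0 < Λ i)
    (horth : (Matrix.fromBlocks Re Re Ro (-Ro))ᵀ * Matrix.fromBlocks Re Re Ro (-Ro) = 1)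
    (hdiag : AcK ((M - 1) / 2) * Matrix.fromBlocks Re Re Ro (-Ro) =
      Matrix.fromBlocks Re Re Ro (-Ro) *
        Matrix.fromBlocks (Matrix.diagonal Λ) 0 0 (-(Matrix.diagonal Λ)))
    (hMR : McK ((M - 1) / 2) * Ro = Re * Matrix.diagonal Λ)
    (hRR : (2 : ℝ) • (Re * Reᵀ) = 1) :
    IsUnit (Hmat ((M - 1) / 2) χ S Re Ro).det := by
  rw [Hmat_eq_mul _ χ S Re Ro Λ hMR hRR, det_mul, det_fromBlocks_zero₂₁, det_one, one_mul]
  have hpos : (χ • S + (2 : ℝ) • (fromRows (0 : Matrix (Fin 1) _ ℝ) Re * Matrix.diagonal Λ *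
      (fromRows 0 Re)ᴴ)).PosDef :=
    (hS.smul hχ).add_posSemidef
      (((PosSemidef.diagonal fun i => (hΛ i).le).mul_mul_conjTranspose_same _).smul zero_le_two)
  exact hpos.det_pos.ne'.isUnit.mul hRe
end

section
/- Let M ≥ 3 be an odd integer, χ̂ > 0, and let H_M(χ) := χ̂S_c·[[1, −ǧ^T R_e],[0, R_e]] + [[0, 0],[0, M̌_c R_o]]. Then for every u^w ∈ R, the linear system H_M(χ)·(a, w)^T = χ̂S_c·(u^w, 0, …, 0)^T in the unknowns a ∈ R and w ∈ R^{(M−1)/2} has the unique solution a = u^w and w = 0. -/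
open Matrix

theorem Matrix.PosDef.eq_zero_of_smul_mulVec_add_eq_zero {n : Type*} [Fintype n]
    {S : Matrix n n ℝ} (hS : S.PosDef) {χ : ℝ} (hχ : 0 < χ) {y z : n → ℝ}
    (h : χ • (S *ᵥ y) + z = 0) (hyz : 0 ≤ y ⬝ᵥ z) : y = 0 := by
  by_contra hy
  have hpos : 0 < y ⬝ᵥ (S *ᵥ y) := by simpa using hS.dotProduct_mulVec_pos hy
  have hsum : χ * (y ⬝ᵥ (S *ᵥ y)) + y ⬝ᵥ z = 0 := by
    simpa [dotProduct_add, dotProduct_smul] using congrArg (y ⬝ᵥ ·) h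
  have := mul_pos hχ hpos
  linarith

theorem mulVec_dotProduct_mulVec_of_two_smul_mul_transpose_eq_one {n : Type*} [Fintype n]
    [DecidableEq n] {R : Matrix n n ℝ} (hR : (2 : ℝ) • (R * Rᵀ) = 1) (v w : n → ℝ) :
    2 * ((R *ᵥ v) ⬝ᵥ (R *ᵥ w)) = v ⬝ᵥ w := by
  have hR' : Rᵀ * ((2 : ℝ) • R) = 1 := by
    rw [mul_eq_one_comm, Matrix.smul_mul, hR]
  calc 2 * ((R *ᵥ v) ⬝ᵥ (R *ᵥ w)) = v ⬝ᵥ ((Rᵀ * ((2 : ℝ) • R)) *ᵥ w) := by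
        rw [← mulVec_mulVec, dotProduct_mulVec v Rᵀ, vecMul_transpose, smul_mulVec,
          dotProduct_smul, smul_eq_mul]
    _ = v ⬝ᵥ w := by rw [hR', one_mulVec]

theorem Hmat_mulVec (k : ℕ) (χ : ℝ) (S : Matrix (Fin 1 ⊕ Fin k) (Fin 1 ⊕ Fin k) ℝ)
    (Re Ro : Matrix (Fin k) (Fin k) ℝ) (a : ℝ) (w : Fin k → ℝ) :
    Hmat k χ S Re Ro *ᵥ Sum.elim (fun _ => a) w =
      χ • (S *ᵥ Sum.elim (fun _ => a - (gCheck k ᵥ* Re) ⬝ᵥ w) (Re *ᵥ w)) +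
        Sum.elim (0 : Fin 1 → ℝ) ((McK k * Ro) *ᵥ w) := by
  have hrow : (Matrix.of fun (_ : Fin 1) j => -(Matrix.vecMul (gCheck k) Re j)) *ᵥ w =
      fun _ => -((gCheck k ᵥ* Re) ⬝ᵥ w) := by
    ext i
    simp [mulVec, dotProduct]
  have htop : (fun _ : Fin 1 => a - (gCheck k ᵥ* Re) ⬝ᵥ w) =
      (fun _ : Fin 1 => a) + fun _ => -((gCheck k ᵥ* Re) ⬝ᵥ w) := by
    ext i
    simp [sub_eq_add_neg]
  rw [Hmat, add_mulVec, smul_mulVec, ← mulVec_mulVec, fromBlocks_mulVec, fromBlocks_mulVec,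
    htop]
  simp only [Sum.elim_comp_inl, Sum.elim_comp_inr, hrow, one_mulVec, zero_mulVec, zero_add,
    add_zero]

/-- For every `u^w ∈ ℝ`, the system `H_M(χ) (a, w)ᵀ = χ̂ S_c (u^w, 0, …, 0)ᵀ`
has the unique solution `a = u^w`, `w = 0`. -/
theorem Hmat_system_unique_solution (M : ℕ) (hM : 3 ≤ M) (hModd : Odd M)
    (χ : ℝ) (hχ : 0 < χ)
    (S : Matrix (Fin 1 ⊕ Fin ((M - 1) / 2)) (Fin 1 ⊕ Fin ((M - 1) / 2)) ℝ)
    (hS : S.PosDef)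
    (Re Ro : Matrix (Fin ((M - 1) / 2)) (Fin ((M - 1) / 2)) ℝ)
    (Λ : Fin ((M - 1) / 2) → ℝ)
    (hRe : IsUnit Re.det) (hRo : IsUnit Ro.det) (hΛ : ∀ i, 0 < Λ i)
    (horth : (Matrix.fromBlocks Re Re Ro (-Ro))ᵀ * Matrix.fromBlocks Re Re Ro (-Ro) = 1)
    (hdiag : AcK ((M - 1) / 2) * Matrix.fromBlocks Re Re Ro (-Ro) =
      Matrix.fromBlocks Re Re Ro (-Ro) *
        Matrix.fromBlocks (Matrix.diagonal Λ) 0 0 (-(Matrix.diagonal Λ)))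
    (hMR : McK ((M - 1) / 2) * Ro = Re * Matrix.diagonal Λ)
    (hRR : (2 : ℝ) • (Re * Reᵀ) = 1) :
    ∀ (uw : ℝ) (a : ℝ) (w : Fin ((M - 1) / 2) → ℝ),
      Hmat ((M - 1) / 2) χ S Re Ro *ᵥ Sum.elim (fun _ => a) w =
          χ • (S *ᵥ Sum.elim (fun _ => uw) 0) ↔
        a = uw ∧ w = 0 := by
  intro uw a w
  rw [Hmat_mulVec]
  constructor
  · intro h
    have hdiff : χ • (S *ᵥ Sum.elim (fun _ => a - uw - (gCheck ((M - 1) / 2) ᵥ* Re) ⬝ᵥ w)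
        (Re *ᵥ w)) + Sum.elim (0 : Fin 1 → ℝ) ((McK ((M - 1) / 2) * Ro) *ᵥ w) = 0 := by
      have hsub : (Sum.elim (fun _ => a - uw - (gCheck ((M - 1) / 2) ᵥ* Re) ⬝ᵥ w) (Re *ᵥ w) :
          Fin 1 ⊕ Fin ((M - 1) / 2) → ℝ) =
          Sum.elim (fun _ => a - (gCheck ((M - 1) / 2) ᵥ* Re) ⬝ᵥ w) (Re *ᵥ w) -
            Sum.elim (fun _ => uw) 0 := by
        ext (i | i)
        · simp only [Sum.elim_inl, Pi.sub_apply]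
          ring
        · simp
      rw [hsub, mulVec_sub, smul_sub, sub_add_eq_add_sub, h, sub_self]
    have hy := hS.eq_zero_of_smul_mulVec_add_eq_zero hχ hdiff (by
      rw [sumElim_dotProduct_sumElim, dotProduct_zero, zero_add, hMR, ← mulVec_mulVec]
      have hquad : 0 ≤ w ⬝ᵥ (diagonal Λ *ᵥ w) := by
        refine Finset.sum_nonneg fun i _ => ?_
        rw [mulVec_diagonal, mul_left_comm]
        exact mul_nonneg (hΛ i).le (mul_self_nonneg _)
      have := mulVec_dotProduct_mulVec_of_two_smul_mul_transpose_eq_one hRR w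
        (diagonal Λ *ᵥ w)
      linarith)
    have hw : w = 0 := by
      refine dotProduct_self_eq_zero.mp ?_
      have hRw : Re *ᵥ w = 0 := funext fun i => congrFun hy (Sum.inr i)
      rw [← mulVec_dotProduct_mulVec_of_two_smul_mul_transpose_eq_one hRR w w, hRw,
        zero_dotProduct, mul_zero]
    refine ⟨?_, hw⟩
    have hfirst := congrFun hy (Sum.inl 0)
    simpa [hw, sub_eq_zero] using hfirst
  · rintro ⟨rfl, rfl⟩
    simp
end

section
/- Let m ≥ n ≥ 1, χ̂ ≥ 0, S ∈ R^{m×m} symmetric positive definite, and M_o ∈ R^{m×n} of full column rank which is lower triangular in the sense that M_o[i,j] = 0 whenever j > i, and with M_o[1,1] ≠ 0. Put A_2 = [[0, M_o],[M_o^T, 0]] ∈ R^{(m+n)×(m+n)}. Define N = { (v_e, v_o) ∈ R^m × R^n : the first component of v_o is 0, and there exists ρ ∈ R with χ̂ M_o^T (v_e − ρ e_1) + (M_o^T S^{-1} M_o) v_o = 0 }, where e_1 is the first standard basis vector of R^m. Then: (i) N is a linear subspace of R^{m+n} of dimension m, and m equals the number of nonnegative eigenvalues of −A_2 counted with multiplicity;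 (ii) for every v ∈ N one has −v^T A_2 v ≥ 0. In other words, the modified Grad boundary conditions together with the no-mass-flow condition are maximal positive. -/
open Matrix

namespace Matrix

section Inertia

variable {ι κ : Type*} [Fintype ι] [DecidableEq ι] [Fintype κ] {B : Matrix ι ι ℝ}

theorem IsHermitian.dotProduct_mulVec_eq_sum_eigenvalues (hB : B.IsHermitian) (x : ι → ℝ) :
    x ⬝ᵥ (B *ᵥ x) =
      ∑ i, hB.eigenvalues i * ((star (hB.eigenvectorUnitary : Matrix ι ι ℝ)) *ᵥ x) i ^ 2 := by
  conv_lhs => rw [hB.spectral_theorem, Unitary.conjStarAlgAut_apply]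
  rw [← mulVec_mulVec, ← mulVec_mulVec, dotProduct_mulVec, ← mulVec_transpose]
  simp only [star_eq_conjTranspose, conjTranspose_eq_transpose_of_trivial, dotProduct,
    mulVec_diagonal, Function.comp_apply, RCLike.ofReal_real_eq_id, id]
  exact Finset.sum_congr rfl fun i _ => by ring

theorem IsHermitian.star_eigenvectorUnitary_mulVec_injective (hB : B.IsHermitian) :
    Function.Injective ((star (hB.eigenvectorUnitary : Matrix ι ι ℝ)) *ᵥ ·) := by
  intro x y h
  have h' := congrArg ((hB.eigenvectorUnitary : Matrix ι ι ℝ) *ᵥ ·) h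
  simpa [mulVec_mulVec] using h'

/-- If the only vector in the range of `L` whose eigencoordinates indexed by `s` all vanish is
the image of `0`, then `s` has at least as many elements as the dimension of the source. -/
theorem IsHermitian.card_le_card_of_eigencoordinates (hB : B.IsHermitian) (s : Finset ι)
    (L : (κ → ℝ) →ₗ[ℝ] ι → ℝ)
    (hL : ∀ y, (∀ i ∈ s, ((star (hB.eigenvectorUnitary : Matrix ι ι ℝ)) *ᵥ L y) i = 0) → y = 0) :
    Fintype.card κ ≤ s.card := by
  let F : (κ → ℝ) →ₗ[ℝ] s → ℝ :=
    LinearMap.funLeft ℝ ℝ (Subtype.val : s → ι) ∘ₗ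
      (star (hB.eigenvectorUnitary : Matrix ι ι ℝ)).mulVecLin ∘ₗ L
  have hF : Function.Injective F := by
    rw [injective_iff_map_eq_zero]
    exact fun y hy => hL y fun i hi => congrFun hy ⟨i, hi⟩
  simpa using LinearMap.finrank_le_finrank_of_injective hF

theorem IsHermitian.card_le_card_neg_eigenvalues (hB : B.IsHermitian)
    (L : (κ → ℝ) →ₗ[ℝ] ι → ℝ) (hL : ∀ y, y ≠ 0 → L y ⬝ᵥ (B *ᵥ L y) < 0) :
    Fintype.card κ ≤ (Finset.univ.filter fun i => ¬ 0 ≤ hB.eigenvalues i).card := by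
  refine hB.card_le_card_of_eigencoordinates _ L fun y hy => ?_
  by_contra hne
  refine (hL y hne).not_ge ?_
  rw [hB.dotProduct_mulVec_eq_sum_eigenvalues]
  refine Finset.sum_nonneg fun i _ => ?_
  by_cases h : 0 ≤ hB.eigenvalues i
  · positivity
  · simp [hy i (by simpa using h)]

theorem IsHermitian.card_le_card_nonneg_eigenvalues (hB : B.IsHermitian)
    (L : (κ → ℝ) →ₗ[ℝ] ι → ℝ) (hinj : Function.Injective L)
    (hL : ∀ y, 0 ≤ L y ⬝ᵥ (B *ᵥ L y)) :
    Fintype.card κ ≤ (Finset.univ.filter fun i => 0 ≤ hB.eigenvalues i).card := by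
  refine hB.card_le_card_of_eigencoordinates _ L fun y hy => ?_
  set c := (star (hB.eigenvectorUnitary : Matrix ι ι ℝ)) *ᵥ L y with hc
  have hterm : ∀ i ∈ Finset.univ, hB.eigenvalues i * c i ^ 2 ≤ 0 := fun i _ => by
    by_cases h : 0 ≤ hB.eigenvalues i
    · simp [hy i (by simpa using h)]
    · exact mul_nonpos_of_nonpos_of_nonneg (not_le.mp h).le (sq_nonneg _)
  have hsum : ∑ i, hB.eigenvalues i * c i ^ 2 = 0 :=
    le_antisymm (Finset.sum_nonpos hterm)
      (hB.dotProduct_mulVec_eq_sum_eigenvalues (L y) ▸ hL y)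
  have hc0 : c = 0 := by
    ext i
    by_cases h : 0 ≤ hB.eigenvalues i
    · exact hy i (by simpa using h)
    · have := (Finset.sum_eq_zero_iff_of_nonpos hterm).1 hsum i (Finset.mem_univ i)
      simpa [(not_le.mp h).ne] using this
  refine hinj (hB.star_eigenvectorUnitary_mulVec_injective ?_)
  simpa using hc0

end Inertia

section OffDiagonal

variable {p q : Type*} [Fintype p] [Fintype q]

theorem dotProduct_fromBlocks_zero_transpose_mulVec (M : Matrix p q ℝ) (v : p ⊕ q → ℝ) :
    v ⬝ᵥ (fromBlocks 0 M Mᵀ 0 *ᵥ v) =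
      2 * ((v ∘ Sum.inr) ⬝ᵥ (Mᵀ *ᵥ (v ∘ Sum.inl))) := by
  have h : (v ∘ Sum.inl) ⬝ᵥ (M *ᵥ (v ∘ Sum.inr)) = (v ∘ Sum.inr) ⬝ᵥ (Mᵀ *ᵥ (v ∘ Sum.inl)) := by
    rw [dotProduct_mulVec, ← mulVec_transpose, dotProduct_comm]
  rw [fromBlocks_mulVec]
  conv_lhs => rw [← Sum.elim_comp_inl_inr v]
  rw [sumElim_dotProduct_sumElim]
  simp only [zero_mulVec, zero_add, add_zero, Sum.elim_comp_inl, Sum.elim_comp_inr, h]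
  ring

theorem card_nonneg_eigenvalues_neg_fromBlocks [DecidableEq p] [DecidableEq q]
    (M : Matrix p q ℝ) (hM : Function.Injective M.mulVec)
    (hA : (-(fromBlocks 0 M Mᵀ 0 : Matrix (p ⊕ q) (p ⊕ q) ℝ)).IsHermitian) :
    (Finset.univ.filter fun i => 0 ≤ hA.eigenvalues i).card = Fintype.card p := by
  let E : (p → ℝ) →ₗ[ℝ] p ⊕ q → ℝ :=
    (LinearEquiv.sumArrowLequivProdArrow p q ℝ ℝ).symm.toLinearMap ∘ₗ LinearMap.inl ℝ _ _
  let G : (q → ℝ) →ₗ[ℝ] p ⊕ q → ℝ :=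
    (LinearEquiv.sumArrowLequivProdArrow p q ℝ ℝ).symm.toLinearMap ∘ₗ
      (M.mulVecLin.prod LinearMap.id)
  have hEl (x : p → ℝ) : E x ∘ Sum.inl = x := rfl
  have hEr (x : p → ℝ) : E x ∘ Sum.inr = 0 := rfl
  have hGl (y : q → ℝ) : G y ∘ Sum.inl = M *ᵥ y := rfl
  have hGr (y : q → ℝ) : G y ∘ Sum.inr = y := rfl
  have hE := hA.card_le_card_nonneg_eigenvalues E
    (fun x y h => by rw [← hEl x, h, hEl]) fun x => by
      rw [neg_mulVec, dotProduct_neg, dotProduct_fromBlocks_zero_transpose_mulVec, hEr]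
      simp
  have hG := hA.card_le_card_neg_eigenvalues G fun y hy => by
    have hMy : M *ᵥ y ≠ 0 := fun h => hy (hM (h.trans (mulVec_zero M).symm))
    have hpos : 0 < (M *ᵥ y) ⬝ᵥ (M *ᵥ y) := by
      simpa using dotProduct_star_self_pos_iff.2 hMy
    rw [neg_mulVec, dotProduct_neg, dotProduct_fromBlocks_zero_transpose_mulVec, hGr, hGl,
      dotProduct_mulVec, vecMul_transpose]
    linarith
  have hcard := Finset.card_filter_add_card_filter_not (s := Finset.univ)
    fun i => 0 ≤ hA.eigenvalues i
  rw [Finset.card_univ, Fintype.card_sum] at hcard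
  omega

end OffDiagonal

section PosDef

variable {q : Type*} [Fintype q] {K : Matrix q q ℝ}

theorem PosDef.eq_zero_of_dotProduct_mulVec_eq_zero (hK : K.PosDef) {y : q → ℝ}
    (h : y ⬝ᵥ (K *ᵥ y) = 0) : y = 0 := by
  by_contra hy
  simpa [h] using hK.dotProduct_mulVec_pos hy

/-- A vector `y` with `y j₀ = 0` is determined by the entries of `K y` away from `j₀`. -/
theorem PosDef.eq_zero_of_mulVec_eq_zero_off (hK : K.PosDef) {y : q → ℝ} (j₀ : q)
    (hy : y j₀ = 0) (h : ∀ j, j ≠ j₀ → (K *ᵥ y) j = 0) : y = 0 := by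
  refine hK.eq_zero_of_dotProduct_mulVec_eq_zero (Finset.sum_eq_zero fun j _ => ?_)
  by_cases hj : j = j₀
  · rw [hj, hy, zero_mul]
  · rw [h j hj, mul_zero]

end PosDef

section Wall

variable {p q : Type*} [Fintype p] [Fintype q] [DecidableEq q]

/-- The wall conditions with the free wall density eliminated: the normal velocity (entry `j₀`)
together with the equations indexed by `j ≠ j₀`. -/
def wallMap (χ : ℝ) (M : Matrix p q ℝ) (K : Matrix q q ℝ) (j₀ : q) :
    (p ⊕ q → ℝ) →ₗ[ℝ] q → ℝ :=
  LinearMap.pi fun j =>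
    if j = j₀ then LinearMap.proj (Sum.inr j₀)
    else LinearMap.proj j ∘ₗ
      (χ • (Mᵀ.mulVecLin ∘ₗ LinearMap.funLeft ℝ ℝ Sum.inl) +
        K.mulVecLin ∘ₗ LinearMap.funLeft ℝ ℝ Sum.inr)

theorem mem_ker_wallMap {χ : ℝ} {M : Matrix p q ℝ} {K : Matrix q q ℝ} {j₀ : q}
    {v : p ⊕ q → ℝ} :
    v ∈ LinearMap.ker (wallMap χ M K j₀) ↔ v (Sum.inr j₀) = 0 ∧
      ∀ j, j ≠ j₀ → χ * (Mᵀ *ᵥ (v ∘ Sum.inl)) j + (K *ᵥ (v ∘ Sum.inr)) j = 0 := by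
  have happ (j : q) (hj : j ≠ j₀) : wallMap χ M K j₀ v j =
      χ * (Mᵀ *ᵥ (v ∘ Sum.inl)) j + (K *ᵥ (v ∘ Sum.inr)) j := by
    simp only [wallMap, LinearMap.pi_apply, if_neg hj]
    rfl
  rw [LinearMap.mem_ker, funext_iff]
  constructor
  · intro h
    exact ⟨by simpa [wallMap] using h j₀, fun j hj => (happ j hj).symm.trans (h j)⟩
  · rintro ⟨h0, h⟩ j
    by_cases hj : j = j₀
    · simpa [wallMap, hj] using h0
    · exact (happ j hj).trans (h j hj)

theorem finrank_ker_wallMap (χ : ℝ) (M : Matrix p q ℝ) {K : Matrix q q ℝ} (hK : K.PosDef)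
    (j₀ : q) : Module.finrank ℝ (LinearMap.ker (wallMap χ M K j₀)) = Fintype.card p := by
  let G : (q → ℝ) →ₗ[ℝ] p ⊕ q → ℝ :=
    (LinearEquiv.sumArrowLequivProdArrow p q ℝ ℝ).symm.toLinearMap ∘ₗ LinearMap.inr ℝ _ _
  have hinj : Function.Injective (wallMap χ M K j₀ ∘ₗ G) := by
    rw [injective_iff_map_eq_zero]
    intro y hy
    obtain ⟨h0, h⟩ := mem_ker_wallMap.1 (LinearMap.mem_ker.2 hy)
    refine hK.eq_zero_of_mulVec_eq_zero_off j₀ h0 fun j hj => ?_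
    have hl : G y ∘ Sum.inl = 0 := rfl
    have hr : G y ∘ Sum.inr = y := rfl
    simpa [hl, hr] using h j hj
  have hsurj : Function.Surjective (wallMap χ M K j₀) :=
    .of_comp (g := G) (LinearMap.injective_iff_surjective.1 hinj)
  have := LinearMap.finrank_range_add_finrank_ker (wallMap χ M K j₀)
  rw [LinearMap.range_eq_top.2 hsurj, finrank_top] at this
  simp only [Module.finrank_fintype_fun_eq_card, Fintype.card_sum] at this
  omega

/-- On the wall subspace the free density is recovered from the equation indexed by `j₀`, since
`Mᵀ e` is a nonzero multiple of the `j₀`-th basis vector. -/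
theorem mem_ker_wallMap_iff_exists {χ : ℝ} {M : Matrix p q ℝ} {K : Matrix q q ℝ}
    (hK : K.PosDef) {j₀ : q} {e : p → ℝ} {c : ℝ} (hc : c ≠ 0) (he : Mᵀ *ᵥ e = Pi.single j₀ c)
    {v : p ⊕ q → ℝ} :
    v ∈ LinearMap.ker (wallMap χ M K j₀) ↔ v (Sum.inr j₀) = 0 ∧
      ∃ ρ : ℝ, χ • (Mᵀ *ᵥ (v ∘ Sum.inl - ρ • e)) + K *ᵥ (v ∘ Sum.inr) = 0 := by
  rw [mem_ker_wallMap]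
  refine and_congr_right fun h0 => ⟨fun h => ?_, ?_⟩
  · rcases eq_or_ne χ 0 with rfl | hχ
    · have hy : v ∘ Sum.inr = 0 :=
        hK.eq_zero_of_mulVec_eq_zero_off j₀ h0 fun j hj => by simpa using h j hj
      exact ⟨0, by simp [hy]⟩
    · refine ⟨(χ * (Mᵀ *ᵥ (v ∘ Sum.inl)) j₀ + (K *ᵥ (v ∘ Sum.inr)) j₀) / (χ * c), ?_⟩
      rw [mulVec_sub, mulVec_smul, he]
      ext j
      by_cases hj : j = j₀
      · subst hj
        simp only [Pi.add_apply, Pi.smul_apply, Pi.sub_apply, Pi.single_eq_same, smul_eq_mul,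
          Pi.zero_apply]
        field_simp
        ring
      · simpa [hj] using h j hj
  · rintro ⟨ρ, h⟩ j hj
    rw [mulVec_sub, mulVec_smul, he] at h
    simpa [hj] using congrFun h j

theorem dotProduct_nonpos_of_mem_ker_wallMap {χ : ℝ} (hχ : 0 ≤ χ) {M : Matrix p q ℝ}
    {K : Matrix q q ℝ} (hK : K.PosDef) {j₀ : q} {v : p ⊕ q → ℝ}
    (hv : v ∈ LinearMap.ker (wallMap χ M K j₀)) :
    (v ∘ Sum.inr) ⬝ᵥ (Mᵀ *ᵥ (v ∘ Sum.inl)) ≤ 0 := by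
  obtain ⟨h0, h⟩ := mem_ker_wallMap.1 hv
  have hsum : χ * ((v ∘ Sum.inr) ⬝ᵥ (Mᵀ *ᵥ (v ∘ Sum.inl))) +
      (v ∘ Sum.inr) ⬝ᵥ (K *ᵥ (v ∘ Sum.inr)) = 0 := by
    rw [← smul_eq_mul, ← dotProduct_smul, ← dotProduct_add]
    refine Finset.sum_eq_zero fun j _ => ?_
    by_cases hj : j = j₀
    · simp [hj, h0]
    · simp [h j hj]
  have hnonneg : 0 ≤ (v ∘ Sum.inr) ⬝ᵥ (K *ᵥ (v ∘ Sum.inr)) := by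
    simpa using hK.posSemidef.dotProduct_mulVec_nonneg (v ∘ Sum.inr)
  by_contra! hpos
  have hy : v ∘ Sum.inr = 0 := hK.eq_zero_of_dotProduct_mulVec_eq_zero
    (by nlinarith [mul_nonneg hχ hpos.le])
  simp [hy] at hpos

end Wall

end Matrix

/-- The modified Grad boundary conditions together with the no-mass-flow condition
are maximal positive: the boundary subspace `N` has dimension `m` (the number of
nonnegative eigenvalues of the boundary matrix `−A₂`, counted with multiplicity),
and `−vᵀ A₂ v ≥ 0` for every `v ∈ N`. -/
theorem modified_grad_bc_maximal_positive
    (m n : ℕ) (hn : 1 ≤ n) (hmn : n ≤ m)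
    (χ : ℝ) (hχ : 0 ≤ χ)
    (S : Matrix (Fin m) (Fin m) ℝ) (hS : S.PosDef)
    (Mo : Matrix (Fin m) (Fin n) ℝ) (hrank : Mo.rank = n)
    (hlow : ∀ (i : Fin m) (j : Fin n), (i : ℕ) < (j : ℕ) → Mo i j = 0)
    (h11 : Mo ⟨0, by omega⟩ ⟨0, by omega⟩ ≠ 0) :
    let A2 : Matrix (Fin m ⊕ Fin n) (Fin m ⊕ Fin n) ℝ :=
      Matrix.fromBlocks 0 Mo Moᵀ 0
    let N : Set ((Fin m ⊕ Fin n) → ℝ) :=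
      {v | v (Sum.inr ⟨0, by omega⟩) = 0 ∧ ∃ ρ : ℝ,
        χ • (Moᵀ *ᵥ fun i => v (Sum.inl i) - ρ * (if (i : ℕ) = 0 then 1 else 0)) +
          (Moᵀ * S⁻¹ * Mo) *ᵥ (fun j => v (Sum.inr j)) = 0}
    (∃ N' : Submodule ℝ ((Fin m ⊕ Fin n) → ℝ),
        (N' : Set ((Fin m ⊕ Fin n) → ℝ)) = N ∧ Module.finrank ℝ N' = m) ∧
    (∀ hA : (-A2).IsHermitian,
        (Finset.univ.filter fun i => 0 ≤ hA.eigenvalues i).card = m) ∧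
    (∀ v ∈ N, 0 ≤ -(v ⬝ᵥ (A2 *ᵥ v))) := by
  intro A2 N
  have hM : Function.Injective Mo.mulVec := by
    rw [mulVec_injective_iff, linearIndependent_iff_card_eq_finrank_span, Fintype.card_fin]
    exact hrank.symm.trans Mo.rank_eq_finrank_span_cols
  have hK : (Moᵀ * S⁻¹ * Mo).PosDef := by
    simpa using hS.inv.conjTranspose_mul_mul_same hM
  let i₀ : Fin m := ⟨0, by omega⟩
  let j₀ : Fin n := ⟨0, by omega⟩
  let e : Fin m → ℝ := fun i => if (i : ℕ) = 0 then 1 else 0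
  have he : Moᵀ *ᵥ e = Pi.single j₀ (Mo i₀ j₀) := by
    have hei : e = Pi.single i₀ 1 := by
      ext i
      simp [e, i₀, Pi.single_apply, Fin.ext_iff]
    rw [hei, mulVec_single_one]
    ext j
    by_cases hj : j = j₀
    · simp [hj]
    · have hj' : (j : ℕ) ≠ 0 := fun h => hj (Fin.ext h)
      simpa [hj] using hlow i₀ j (Nat.pos_of_ne_zero hj')
  have hN : (LinearMap.ker (wallMap χ Mo (Moᵀ * S⁻¹ * Mo) j₀) : Set _) = N :=
    Set.ext fun v => mem_ker_wallMap_iff_exists hK h11 he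
  refine ⟨⟨_, hN, by simpa using finrank_ker_wallMap χ Mo hK j₀⟩, fun hA => ?_, fun v hv => ?_⟩
  · simpa using card_nonneg_eigenvalues_neg_fromBlocks Mo hM hA
  · rw [← hN] at hv
    have := dotProduct_nonpos_of_mem_ker_wallMap hχ hK hv
    rw [dotProduct_fromBlocks_zero_transpose_mulVec]
    linarith
end

section
/- Let M ≥ 3 be an odd integer and let R_e, R_o, Λ_+ be as in the orthogonal block diagonalization of Ǎ_c. Then a differentiable function w : [0,∞) → R^{M−1} is a bounded solution of the ODE system Ǎ_c w′(z) = −w(z) if and only if there exists v ∈ R^{(M−1)/2} such that w(z) = [R_e; R_o] · exp(−Λ_+^{-1} z) · v for all z ≥ 0 (where [R_e; R_o] denotes the vertical block matrix and exp(−Λ_+^{-1}z) the diagonal matrix exponential); in particular every bounded solution decays to 0 as z → ∞. -/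
open Matrix

theorem eq_mul_exp_of_hasDerivAt {f f' : ℝ → ℝ} {c : ℝ}
    (hf : ∀ z ∈ Set.Ici (0 : ℝ), HasDerivAt f (f' z) z)
    (hode : ∀ z ∈ Set.Ici (0 : ℝ), f' z = -c * f z) {z : ℝ} (hz : z ∈ Set.Ici (0 : ℝ)) :
    f z = f 0 * Real.exp (-c * z) := by
  have hderiv : ∀ x ∈ Set.Ici (0 : ℝ),
      HasDerivAt (fun x => f x * Real.exp (c * x)) 0 x := by
    intro x hx
    have hexp : HasDerivAt (fun x => Real.exp (c * x)) (Real.exp (c * x) * (c * 1)) x :=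
      ((hasDerivAt_id x).const_mul c).exp
    refine ((hf x hx).mul hexp).congr_deriv ?_
    rw [hode x hx]
    ring
  have hconst := constant_of_has_deriv_right_zero (a := 0) (b := z)
    (fun x hx => (hderiv x hx.1).continuousAt.continuousWithinAt)
    (fun x hx => (hderiv x hx.1).hasDerivWithinAt) z ⟨hz, le_rfl⟩
  simp only [mul_zero, Real.exp_zero, mul_one] at hconst
  rw [← hconst, mul_assoc, ← Real.exp_add]
  simp

theorem eq_zero_of_abs_mul_exp_le {a b B : ℝ} (hb : 0 < b)
    (h : ∀ z ∈ Set.Ici (0 : ℝ), |a * Real.exp (b * z)| ≤ B) : a = 0 := by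
  by_contra ha
  have hlim : Filter.Tendsto (fun z => |a| * Real.exp (b * z)) Filter.atTop Filter.atTop :=
    (Real.tendsto_exp_atTop.comp (Filter.tendsto_id.const_mul_atTop hb)).const_mul_atTop
      (abs_pos.mpr ha)
  obtain ⟨z, hz, hz0⟩ :=
    ((hlim.eventually_gt_atTop B).and (Filter.eventually_ge_atTop 0)).exists
  have := h z hz0
  rw [abs_mul, Real.abs_exp] at this
  linarith

theorem Matrix.hasDerivAt_mulVec {m n : Type*} [Fintype m] [Fintype n] (A : Matrix m n ℝ)
    {u : ℝ → n → ℝ} {u' : n → ℝ} {z : ℝ} (hu : HasDerivAt u u' z) :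
    HasDerivAt (fun x => A *ᵥ u x) (A *ᵥ u') z :=
  A.mulVecLin.toContinuousLinearMap.hasFDerivAt.comp_hasDerivAt z hu

section Diagonalization

variable {n : Type*} [Fintype n] [DecidableEq n]

/-- In orthonormal eigencoordinates, the solutions of `A w' = -w` are exponentials. -/
theorem eigencoordinate_eq_mul_exp {A R : Matrix n n ℝ} {d : n → ℝ} (hd : ∀ i, d i ≠ 0)
    (hR : Rᵀ * R = 1) (hA : A * R = R * diagonal d) {w w' : ℝ → n → ℝ}
    (hw : ∀ z ∈ Set.Ici (0 : ℝ), HasDerivAt w (w' z) z)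
    (hode : ∀ z ∈ Set.Ici (0 : ℝ), A *ᵥ w' z = -(w z)) (i : n)
    {z : ℝ} (hz : z ∈ Set.Ici (0 : ℝ)) :
    (Rᵀ *ᵥ w z) i = (Rᵀ *ᵥ w 0) i * Real.exp (-(d i)⁻¹ * z) := by
  have hRA : Rᵀ * A = diagonal d * Rᵀ := by
    calc Rᵀ * A = Rᵀ * (A * R) * Rᵀ := by
          simp only [Matrix.mul_assoc, mul_eq_one_comm.mp hR, Matrix.mul_one]
      _ = diagonal d * Rᵀ := by rw [hA, ← Matrix.mul_assoc, hR, Matrix.one_mul]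
  refine eq_mul_exp_of_hasDerivAt (f := fun z => (Rᵀ *ᵥ w z) i)
    (f' := fun z => (Rᵀ *ᵥ w' z) i)
    (fun x hx => hasDerivAt_pi.mp (Rᵀ.hasDerivAt_mulVec (hw x hx)) i) (fun x hx => ?_) hz
  have h := congrFun (congrArg (Rᵀ *ᵥ ·) (hode x hx)) i
  simp only [mulVec_mulVec, hRA, mulVec_neg, Pi.neg_apply] at h
  rw [← mulVec_mulVec, mulVec_diagonal] at h
  have hdi := hd i
  field_simp
  rwa [mul_comm]

theorem mulVec_deriv_eq_neg_of_eigencoordinates {A R : Matrix n n ℝ} {d : n → ℝ}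
    (hd : ∀ i, d i ≠ 0) (hA : A * R = R * diagonal d) (a : n → ℝ) {w w' : ℝ → n → ℝ}
    (hw : ∀ z ∈ Set.Ici (0 : ℝ), HasDerivAt w (w' z) z)
    (hsol : ∀ z ∈ Set.Ici (0 : ℝ), w z = R *ᵥ fun i => Real.exp (-(d i)⁻¹ * z) * a i)
    {z : ℝ} (hz : z ∈ Set.Ici (0 : ℝ)) : A *ᵥ w' z = -(w z) := by
  have hu : HasDerivAt (fun x i => Real.exp (-(d i)⁻¹ * x) * a i)
      (fun i => Real.exp (-(d i)⁻¹ * z) * (-(d i)⁻¹ * 1) * a i) z :=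
    hasDerivAt_pi.mpr fun i =>
      (((hasDerivAt_id z).const_mul (-(d i)⁻¹)).exp).mul_const (a i)
  have hw' : w' z = R *ᵥ fun i => Real.exp (-(d i)⁻¹ * z) * (-(d i)⁻¹ * 1) * a i :=
    (uniqueDiffOn_Ici (0 : ℝ) z hz).eq_deriv _ (hw z hz).hasDerivWithinAt
      ((R.hasDerivAt_mulVec hu).hasDerivWithinAt.congr hsol (hsol z hz))
  rw [hw', mulVec_mulVec, hA, ← mulVec_mulVec, hsol z hz, ← mulVec_neg]
  congr 1
  funext i
  have hdi := hd i
  rw [mulVec_diagonal, Pi.neg_apply]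
  field_simp

end Diagonalization

theorem mulVec_stack_eq_fromBlocks_mulVec {k : Type*} [Fintype k] (Re Ro : Matrix k k ℝ)
    (y : k → ℝ) :
    (Matrix.of fun i j => Sum.elim (fun i' => Re i' j) (fun i' => Ro i' j) i) *ᵥ y =
      Matrix.fromBlocks Re Re Ro (-Ro) *ᵥ Sum.elim y 0 := by
  rw [fromBlocks_mulVec]
  ext (i | i) <;> simp [mulVec, dotProduct]

theorem tendsto_mulVec_exp_decay {m k : Type*} [Fintype m] [Fintype k] [DecidableEq k]
    (E : Matrix m k ℝ) {Λ : k → ℝ} (hΛ : ∀ i, 0 < Λ i) (v : k → ℝ) :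
    Filter.Tendsto
      (fun z => E *ᵥ (diagonal (fun i => Real.exp (-(Λ i)⁻¹ * z)) *ᵥ v))
      Filter.atTop (nhds 0) := by
  have hu : Filter.Tendsto (fun z : ℝ => diagonal (fun i => Real.exp (-(Λ i)⁻¹ * z)) *ᵥ v)
      Filter.atTop (nhds 0) := by
    refine tendsto_pi_nhds.mpr fun i => ?_
    simp only [mulVec_diagonal, Pi.zero_apply]
    have hexp : Filter.Tendsto (fun z => Real.exp (-(Λ i)⁻¹ * z)) Filter.atTop (nhds 0) :=
      Real.tendsto_exp_atBot.comp
        (Filter.tendsto_id.const_mul_atTop_of_neg (neg_neg_of_pos (inv_pos.mpr (hΛ i))))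
    simpa using hexp.mul_const (v i)
  have hE := (E.mulVecLin.toContinuousLinearMap.continuous.tendsto 0).comp hu
  rwa [map_zero] at hE

theorem exists_norm_mulVec_exp_le {m k : Type*} [Fintype m] [Fintype k] [DecidableEq k]
    (E : Matrix m k ℝ) {Λ : k → ℝ} (hΛ : ∀ i, 0 < Λ i) (v : k → ℝ) :
    ∃ C : ℝ, ∀ z ∈ Set.Ici (0 : ℝ),
      ‖E *ᵥ (diagonal (fun i => Real.exp (-(Λ i)⁻¹ * z)) *ᵥ v)‖ ≤ C := by
  let L := E.mulVecLin.toContinuousLinearMap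
  refine ⟨‖L‖ * ‖v‖, fun z hz => L.le_opNorm_of_le ?_⟩
  refine (pi_norm_le_iff_of_nonneg (norm_nonneg v)).mpr fun i => ?_
  rw [mulVec_diagonal, norm_mul, Real.norm_eq_abs, Real.abs_exp]
  have hexp : Real.exp (-(Λ i)⁻¹ * z) ≤ 1 := Real.exp_le_one_iff.mpr
    (mul_nonpos_of_nonpos_of_nonneg (neg_nonpos.mpr (inv_pos.mpr (hΛ i)).le) hz)
  exact (mul_le_of_le_one_left (norm_nonneg _) hexp).trans (norm_le_pi_norm v i)

/-- A differentiable `w : [0,∞) → ℝ^{M−1}` is a bounded solution of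
`Ǎ_c w′(z) = −w(z)` iff `w(z) = [R_e; R_o] · exp(−Λ₊⁻¹ z) · v` for some `v`; in
particular every bounded solution decays to `0` as `z → ∞`. -/
theorem knudsen_layer_ode_bounded_solutions (M : ℕ) (hM : 3 ≤ M) (hModd : Odd M)
    (Re Ro : Matrix (Fin ((M - 1) / 2)) (Fin ((M - 1) / 2)) ℝ)
    (Λ : Fin ((M - 1) / 2) → ℝ)
    (hRe : IsUnit Re.det) (hRo : IsUnit Ro.det) (hΛ : ∀ i, 0 < Λ i)
    (horth : (Matrix.fromBlocks Re Re Ro (-Ro))ᵀ * Matrix.fromBlocks Re Re Ro (-Ro) = 1)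
    (hdiag : AcK ((M - 1) / 2) * Matrix.fromBlocks Re Re Ro (-Ro) =
      Matrix.fromBlocks Re Re Ro (-Ro) *
        Matrix.fromBlocks (Matrix.diagonal Λ) 0 0 (-(Matrix.diagonal Λ)))
    (w w' : ℝ → (Fin ((M - 1) / 2) ⊕ Fin ((M - 1) / 2)) → ℝ)
    (hw : ∀ z ∈ Set.Ici (0 : ℝ), HasDerivAt w (w' z) z) :
    (((∃ Cb : ℝ, ∀ z ∈ Set.Ici (0 : ℝ), ‖w z‖ ≤ Cb) ∧
        ∀ z ∈ Set.Ici (0 : ℝ), AcK ((M - 1) / 2) *ᵥ w' z = -(w z)) ↔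
      ∃ v : Fin ((M - 1) / 2) → ℝ, ∀ z ∈ Set.Ici (0 : ℝ),
        w z = (Matrix.of fun i j =>
            Sum.elim (fun i' => Re i' j) (fun i' => Ro i' j) i) *ᵥ
          (Matrix.diagonal (fun i => Real.exp (-(Λ i)⁻¹ * z)) *ᵥ v)) ∧
    (((∃ Cb : ℝ, ∀ z ∈ Set.Ici (0 : ℝ), ‖w z‖ ≤ Cb) ∧
        ∀ z ∈ Set.Ici (0 : ℝ), AcK ((M - 1) / 2) *ᵥ w' z = -(w z)) →
      Filter.Tendsto w Filter.atTop (nhds 0)) := by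
  rw [diagonal_neg, fromBlocks_diagonal] at hdiag
  set R := Matrix.fromBlocks Re Re Ro (-Ro) with hRdef
  set d : Fin ((M - 1) / 2) ⊕ Fin ((M - 1) / 2) → ℝ := Sum.elim Λ (fun i => -Λ i) with hddef
  have hd : ∀ i, d i ≠ 0 := by
    rintro (i | i)
    · exact (hΛ i).ne'
    · exact (neg_neg_of_pos (hΛ i)).ne
  have hforward : ((∃ Cb : ℝ, ∀ z ∈ Set.Ici (0 : ℝ), ‖w z‖ ≤ Cb) ∧
        ∀ z ∈ Set.Ici (0 : ℝ), AcK ((M - 1) / 2) *ᵥ w' z = -(w z)) →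
      ∃ v : Fin ((M - 1) / 2) → ℝ, ∀ z ∈ Set.Ici (0 : ℝ),
        w z = (Matrix.of fun i j =>
            Sum.elim (fun i' => Re i' j) (fun i' => Ro i' j) i) *ᵥ
          (Matrix.diagonal (fun i => Real.exp (-(Λ i)⁻¹ * z)) *ᵥ v) := by
    rintro ⟨⟨C, hC⟩, hode⟩
    have hu := fun i z hz => eigencoordinate_eq_mul_exp (z := z) hd horth hdiag hw hode i hz
    have hgrow : ∀ i, (Rᵀ *ᵥ w 0) (Sum.inr i) = 0 := by
      intro i
      let L := Rᵀ.mulVecLin.toContinuousLinearMap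
      refine eq_zero_of_abs_mul_exp_le (inv_pos.mpr (hΛ i)) (B := ‖L‖ * C) fun z hz => ?_
      have h := hu (Sum.inr i) z hz
      simp only [hddef, Sum.elim_inr, inv_neg, neg_neg] at h
      rw [← h, ← Real.norm_eq_abs]
      exact (norm_le_pi_norm (L (w z)) (Sum.inr i)).trans (L.le_opNorm_of_le (hC z hz))
    refine ⟨fun i => (Rᵀ *ᵥ w 0) (Sum.inl i), fun z hz => ?_⟩
    have hw_eq : w z = R *ᵥ (Rᵀ *ᵥ w z) := by
      rw [mulVec_mulVec, mul_eq_one_comm.mp horth, one_mulVec]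
    rw [mulVec_stack_eq_fromBlocks_mulVec, hw_eq, ← hRdef]
    congr 1
    ext (i | i)
    · rw [hu _ z hz, Sum.elim_inl, mulVec_diagonal, mul_comm]
      rfl
    · rw [hu _ z hz, hgrow, zero_mul]
      rfl
  refine ⟨⟨hforward, ?_⟩, fun h => ?_⟩
  · rintro ⟨v, hv⟩
    refine ⟨?_, fun z hz => mulVec_deriv_eq_neg_of_eigencoordinates hd hdiag (Sum.elim v 0) hw
      (fun x hx => ?_) hz⟩
    · obtain ⟨C, hC⟩ := exists_norm_mulVec_exp_le
        (Matrix.of fun i j => Sum.elim (fun i' => Re i' j) (fun i' => Ro i' j) i) hΛ v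
      exact ⟨C, fun z hz => (congrArg norm (hv z hz)).trans_le (hC z hz)⟩
    · rw [hv x hx, mulVec_stack_eq_fromBlocks_mulVec, ← hRdef]
      congr 1
      ext (i | i) <;> simp [hddef, mulVec_diagonal]
  · obtain ⟨v, hv⟩ := hforward h
    exact (tendsto_mulVec_exp_decay _ hΛ v).congr'
      ((Filter.eventually_ge_atTop 0).mono fun z hz => (hv z hz).symm)
end
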